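/- Fourier multiplier of the reduced X-ray transform: let g : ℂ×ℝ → ℂ be π-periodic in t with g ∈ L¹(ℂ×[0,π)). Then for every n ∈ ℤ∖{0}, every F ∈ 𝓗 and every ζ ∈ ℂ, ∫_{ℂ×[0,π)} (I^red g)(z,t) · (β_n(z,t)*F)(ζ) dz dt = 2π · (𝒥_n G)(ζ), where I^red g(z,t) = ∫₀^{2π} g((z,t)·γ_1(s)) ds with γ_1(s) = (e^{is}, s/2), and G(ζ) = ∫_{ℂ×[0,π)} g(z,t)(β_n(z,t)*F)(ζ) dz dt. -/

import Mathlib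

noncomputable section

open Complex MeasureTheory Real Set

/-- Heisenberg group multiplication on ℂ × ℝ. -/
def hmul (p q : ℂ × ℝ) : ℂ × ℝ :=
  (p.1 + q.1, p.2 + q.2 + (p.1.re * q.1.im - p.1.im * q.1.re) / 2)

/-- The model sub-Riemannian geodesic of charge `lam`:
`γ_λ(s) = (R e^{i s / R}, s R / 2)` with `R = 1/λ`. -/
def geo (lam : ℝ) (s : ℝ) : ℂ × ℝ :=
  (((lam : ℂ))⁻¹ * Complex.exp (Complex.I * ((lam * s : ℝ) : ℂ)), s / (2 * lam))

/-- The sub-Riemannian X-ray transform `I_λ f (z,t) = ∫ f((z,t)·γ_λ(s)) ds`. -/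
def xray (lam : ℝ) (f : ℂ × ℝ → ℂ) (p : ℂ × ℝ) : ℂ :=
  ∫ s : ℝ, f (hmul p (geo lam s))

/-- The Bargmann–Fock representation for `h > 0`, acting pointwise. -/
def betaP (h : ℝ) (z : ℂ) (t : ℝ) (F : ℂ → ℂ) (ζ : ℂ) : ℂ :=
  Complex.exp (2 * Complex.I * (h : ℂ) * (t : ℂ) - ((Real.sqrt h : ℝ) : ℂ) * ζ * (starRingEnd ℂ) z
      - ((h : ℂ) / 2) * ((Complex.normSq z : ℝ) : ℂ)) * F (ζ + ((Real.sqrt h : ℝ) : ℂ) * z)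

/-- The Bargmann–Fock representation `β_h(z,t)` for `h ≠ 0`:
for `h < 0` it is `β_{|h|}(conj z, −t)`. -/
def beta (h : ℝ) (z : ℂ) (t : ℝ) (F : ℂ → ℂ) (ζ : ℂ) : ℂ :=
  if 0 < h then betaP h z t F ζ else betaP |h| ((starRingEnd ℂ) z) (-t) F ζ

/-- The adjoint `β_h(z,t)* = β_h((z,t)⁻¹) = β_h(−z,−t)`. -/
def betaStar (h : ℝ) (p : ℂ × ℝ) (F : ℂ → ℂ) (ζ : ℂ) : ℂ :=
  beta h (-p.1) (-p.2) F ζ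

/-- Membership in Bargmann–Fock space `𝓗`: entire with
`(1/π) ∫_ℂ |F(ζ)|² e^{−|ζ|²} dζ < ∞`. -/
def InFock (F : ℂ → ℂ) : Prop :=
  Differentiable ℂ F ∧
    Integrable (fun ζ : ℂ => ‖F ζ‖ ^ 2 * Real.exp (-Complex.normSq ζ))

/-- The group Fourier transform `𝓕_ℍ f(h)`, acting pointwise on `F ∈ 𝓗`:
`(𝓕_ℍ f(h) F)(ζ) = ∫_{ℂ×ℝ} f(z,t) (β_h(z,t)* F)(ζ) dz dt`. -/
def fourierH (f : ℂ × ℝ → ℂ) (h : ℝ) (F : ℂ → ℂ) (ζ : ℂ) : ℂ :=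
  ∫ p : ℂ × ℝ, f p * betaStar h p F ζ

/-- The multiplier operator `𝒥_n(r)`:
`(𝒥_n(r) F)(ζ) = (1/2π) ∫₀^{2π} (β_n(r e^{iθ}, θ/2) F)(ζ) dθ`. -/
def Jop (n : ℤ) (r : ℝ) (F : ℂ → ℂ) (ζ : ℂ) : ℂ :=
  ((1 / (2 * π) : ℝ) : ℂ) *
    ∫ θ in (0 : ℝ)..(2 * π), beta (n : ℝ) (((r : ℝ) : ℂ) * Complex.exp (Complex.I * (θ : ℂ))) (θ / 2) F ζ

/-- Weighted sub-mean value inequality for an entire function. -/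
theorem enorm_apply_zero_le_lintegral_gaussian {H : ℂ → ℂ} (hH : Differentiable ℂ H) :
    ENNReal.ofReal (Real.exp (-4)) * ‖H 0‖ₑ ≤
      ∫⁻ w : ℂ, ENNReal.ofReal (Real.exp (-Complex.normSq w)) * ‖H w‖ₑ := by
  have circle (r : ℝ) : ‖H 0‖ₑ ≤
      ∫⁻ θ in Ioo (-π) π, ‖H (Complex.polarCoord.symm (r, θ))‖ₑ := by
    have h1 : circleAverage H 0 r = H 0 := hH.diffContOnCl.circleAverage
    rw [circleAverage_eq_integral_add (-π),
      intervalIntegral.integral_comp_add_right (fun θ => H (circleMap 0 r θ)),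
      intervalIntegral.integral_of_le (by linarith [pi_pos])] at h1
    rw [show 2 * π + -π = π by ring, zero_add, integral_Ioc_eq_integral_Ioo] at h1
    have h2 : ‖∫ θ in Ioo (-π) π, H (circleMap 0 r θ)‖ₑ ≤
        ∫⁻ θ in Ioo (-π) π, ‖H (Complex.polarCoord.symm (r, θ))‖ₑ := by
      refine (enorm_integral_le_lintegral_enorm _).trans (le_of_eq ?_)
      refine lintegral_congr fun θ => ?_
      congr 2
      simp [circleMap, Complex.polarCoord_symm_apply, Complex.exp_mul_I]
    refine le_trans ?_ h2
    rw [← h1, enorm_smul]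
    refine mul_le_of_le_one_left (zero_le) ?_
    rw [enorm_inv two_pi_pos.ne', ENNReal.inv_le_one, Real.enorm_eq_ofReal two_pi_pos.le]
    rw [ENNReal.one_le_ofReal]
    linarith [pi_gt_three]
  rw [← Complex.lintegral_comp_polarCoord_symm, polarCoord_target, Measure.volume_eq_prod,
    ← Measure.prod_restrict, lintegral_prod]
  · calc ENNReal.ofReal (Real.exp (-4)) * ‖H 0‖ₑ
        = ∫⁻ _ in Ioo (1 : ℝ) 2, ENNReal.ofReal (Real.exp (-4)) * ‖H 0‖ₑ := by
          simp only [lintegral_const, Measure.restrict_apply_univ, Real.volume_Ioo]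
          norm_num
      _ ≤ ∫⁻ r in Ioo (1 : ℝ) 2, ∫⁻ θ in Ioo (-π) π, ENNReal.ofReal r •
          (ENNReal.ofReal (Real.exp (-Complex.normSq (Complex.polarCoord.symm (r, θ)))) *
            ‖H (Complex.polarCoord.symm (r, θ))‖ₑ) := by
          refine setLIntegral_mono' measurableSet_Ioo fun r hr => ?_
          calc ENNReal.ofReal (Real.exp (-4)) * ‖H 0‖ₑ
              ≤ ENNReal.ofReal (Real.exp (-4)) *
                  ∫⁻ θ in Ioo (-π) π, ‖H (Complex.polarCoord.symm (r, θ))‖ₑ := by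
                gcongr; exact circle r
            _ = ∫⁻ θ in Ioo (-π) π, ENNReal.ofReal (Real.exp (-4)) *
                  ‖H (Complex.polarCoord.symm (r, θ))‖ₑ := by
                rw [lintegral_const_mul']
                exact ENNReal.ofReal_ne_top
            _ ≤ _ := by
                refine lintegral_mono fun θ => ?_
                rw [smul_eq_mul, ← mul_assoc, ← ENNReal.ofReal_mul (by linarith [hr.1])]
                gcongr
                have : Complex.normSq (Complex.polarCoord.symm (r, θ)) = r ^ 2 := by
                  rw [Complex.normSq_eq_norm_sq, Complex.norm_polarCoord_symm, sq_abs]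
                rw [this]
                calc Real.exp (-4) ≤ Real.exp (-r ^ 2) := by
                      gcongr; nlinarith [hr.1, hr.2]
                  _ ≤ r * Real.exp (-r ^ 2) :=
                      le_mul_of_one_le_left (Real.exp_pos _).le hr.1.le
      _ ≤ _ := lintegral_mono_set fun r hr => lt_trans one_pos hr.1
  · refine Measurable.aemeasurable ?_
    have : Measurable H := hH.continuous.measurable
    have h2 : Measurable fun p : ℝ × ℝ => Complex.polarCoord.symm p := by
      simp only [Complex.polarCoord_symm_apply]
      fun_prop
    refine Measurable.smul (measurable_fst.ennreal_ofReal) (Measurable.mul (M := ENNReal) ?_ ?_)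
    · exact (Complex.continuous_normSq.measurable.comp h2).neg.exp.ennreal_ofReal
    · exact (this.comp h2).enorm

theorem InFock.exists_norm_sq_le {F : ℂ → ℂ} (hF : InFock F) :
    ∃ C : ℝ, ∀ ζ : ℂ, ‖F ζ‖ ^ 2 ≤ C * Real.exp (Complex.normSq ζ) := by
  set M : ℝ := ∫ ζ : ℂ, ‖F ζ‖ ^ 2 * Real.exp (-Complex.normSq ζ) with hM
  refine ⟨Real.exp 4 * M, fun ζ => ?_⟩
  have hd := hF.1
  have key := enorm_apply_zero_le_lintegral_gaussian
    (H := fun w => (F (w + ζ) * Complex.exp (-(w * (starRingEnd ℂ) ζ))) ^ 2) (by fun_prop)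
  have e : ∀ w : ℂ, ENNReal.ofReal (Real.exp (-Complex.normSq w)) *
      ‖(F (w + ζ) * Complex.exp (-(w * (starRingEnd ℂ) ζ))) ^ 2‖ₑ =
      ENNReal.ofReal (Real.exp (Complex.normSq ζ)) *
        ENNReal.ofReal (‖F (w + ζ)‖ ^ 2 * Real.exp (-Complex.normSq (w + ζ))) := by
    intro w
    rw [← ofReal_norm, ← ENNReal.ofReal_mul (Real.exp_pos _).le,
      ← ENNReal.ofReal_mul (Real.exp_pos _).le, norm_pow, norm_mul, Complex.norm_exp, mul_pow,
      ← Real.exp_nat_mul, mul_left_comm, ← Real.exp_add, mul_left_comm, ← Real.exp_add]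
    congr 3
    simp [Complex.normSq_apply]
    ring
  simp_rw [e] at key
  rw [lintegral_const_mul' _ _ ENNReal.ofReal_ne_top,
    lintegral_add_right_eq_self
      (fun w => ENNReal.ofReal (‖F w‖ ^ 2 * Real.exp (-Complex.normSq w))) ζ,
    ← ofReal_integral_eq_lintegral_ofReal hF.2 (ae_of_all _ fun w => by positivity), ← hM,
    ← ofReal_norm, ← ENNReal.ofReal_mul (Real.exp_pos _).le,
    ← ENNReal.ofReal_mul (Real.exp_pos _).le] at key
  have hM0 : 0 ≤ M := integral_nonneg fun w => by positivity
  rw [ENNReal.ofReal_le_ofReal_iff (by positivity)] at key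
  simp only [zero_add, zero_mul, neg_zero, Complex.exp_zero, mul_one, norm_pow] at key
  calc ‖F ζ‖ ^ 2 = Real.exp 4 * (Real.exp (-4) * ‖F ζ‖ ^ 2) := by
        rw [← mul_assoc, ← Real.exp_add]; simp
    _ ≤ Real.exp 4 * (Real.exp (Complex.normSq ζ) * M) := by gcongr
    _ = _ := by ring

theorem norm_betaP_sq_le {F : ℂ → ℂ} {C h : ℝ} (hh : 0 ≤ h)
    (hC : ∀ ζ : ℂ, ‖F ζ‖ ^ 2 ≤ C * Real.exp (Complex.normSq ζ)) (z : ℂ) (t : ℝ) (ζ : ℂ) :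
    ‖betaP h z t F ζ‖ ^ 2 ≤ C * Real.exp (Complex.normSq ζ) := by
  have hs : √h * √h = h := Real.mul_self_sqrt hh
  rw [betaP, norm_mul, mul_pow, Complex.norm_exp, ← Real.exp_nat_mul]
  refine (mul_le_mul_of_nonneg_left (hC _) (Real.exp_pos _).le).trans (le_of_eq ?_)
  rw [mul_left_comm, ← Real.exp_add]
  congr 2
  simp [Complex.normSq_apply]
  linear_combination (z.re * z.re + z.im * z.im) * hs

theorem InFock.exists_norm_betaStar_le {F : ℂ → ℂ} (hF : InFock F) (h : ℝ) (ζ : ℂ) :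
    ∃ C : ℝ, ∀ p : ℂ × ℝ, ‖betaStar h p F ζ‖ ≤ C := by
  obtain ⟨C, hC⟩ := hF.exists_norm_sq_le
  refine ⟨√(C * Real.exp (Complex.normSq ζ)), fun p => Real.le_sqrt_of_sq_le ?_⟩
  unfold betaStar beta
  split_ifs with h0
  · exact norm_betaP_sq_le h0.le hC _ _ _
  · exact norm_betaP_sq_le (abs_nonneg h) hC _ _ _

theorem continuous_betaStar {F : ℂ → ℂ} (hF : Continuous F) (h : ℝ) (ζ : ℂ) :
    Continuous fun p : ℂ × ℝ => betaStar h p F ζ := by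
  unfold betaStar beta betaP
  split_ifs
  · have := Complex.continuous_normSq
    fun_prop
  · have := Complex.continuous_normSq
    fun_prop

theorem betaP_hmul {h : ℝ} (hh : 0 ≤ h) (p q : ℂ × ℝ) (F : ℂ → ℂ) (ζ : ℂ) :
    betaP h (hmul p q).1 (hmul p q).2 F ζ =
      betaP h p.1 p.2 (fun ξ => betaP h q.1 q.2 F ξ) ζ := by
  have hs : ((√h : ℝ) : ℂ) * ((√h : ℝ) : ℂ) = (h : ℂ) := by
    rw [← Complex.ofReal_mul, Real.mul_self_sqrt hh]
  obtain ⟨z, t⟩ := p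
  obtain ⟨w, s⟩ := q
  simp only [betaP, hmul]
  rw [← mul_assoc, ← Complex.exp_add, mul_add]
  congr 2
  · have hc : Complex.I * ((z.re * w.im - z.im * w.re : ℝ) : ℂ) =
        ((starRingEnd ℂ) z * w - z * (starRingEnd ℂ) w) / 2 := by
      apply Complex.ext
      · simp
      · simp
        ring
    simp only [Complex.normSq_eq_conj_mul_self, map_add]
    push_cast at hc ⊢
    linear_combination (h : ℂ) * hc + z * (starRingEnd ℂ) w * hs
  · ring_nf

theorem beta_hmul (h : ℝ) (p q : ℂ × ℝ) (F : ℂ → ℂ) (ζ : ℂ) :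
    beta h (hmul p q).1 (hmul p q).2 F ζ =
      beta h p.1 p.2 (fun ξ => beta h q.1 q.2 F ξ) ζ := by
  unfold beta
  split_ifs with h0
  · exact betaP_hmul h0.le p q F ζ
  · rw [← betaP_hmul (abs_nonneg h) ((starRingEnd ℂ) p.1, -p.2) ((starRingEnd ℂ) q.1, -q.2)]
    congr 1
    · simp [hmul]
    · simp [hmul]
      ring

theorem betaStar_hmul_inv (h : ℝ) (p q : ℂ × ℝ) (F : ℂ → ℂ) (ζ : ℂ) :
    betaStar h (hmul p (-q)) F ζ = beta h q.1 q.2 (fun ξ => betaStar h p F ξ) ζ := by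
  unfold betaStar
  rw [← beta_hmul h q (-p.1, -p.2)]
  congr 1
  · simp [hmul]
  · simp [hmul]
    ring

theorem betaStar_add_pi (n : ℤ) (z : ℂ) (t : ℝ) (F : ℂ → ℂ) (ζ : ℂ) :
    betaStar n (z, t + π) F ζ = betaStar n (z, t) F ζ := by
  unfold betaStar beta betaP
  split_ifs with h0
  · congr 1
    rw [Complex.exp_eq_exp_iff_exists_int]
    exact ⟨-n, by push_cast; ring⟩
  · congr 1
    rw [Complex.exp_eq_exp_iff_exists_int]
    refine ⟨-n, ?_⟩
    rw [abs_of_nonpos (not_lt.1 h0)]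
    push_cast; ring

theorem beta_integral {α : Type*} [MeasurableSpace α] (μ : Measure α) (h : ℝ) (z : ℂ) (t : ℝ)
    (g : α → ℂ) (B : α → ℂ → ℂ) (ζ : ℂ) :
    beta h z t (fun ξ => ∫ p, g p * B p ξ ∂μ) ζ = ∫ p, g p * beta h z t (B p) ζ ∂μ := by
  unfold beta betaP
  split_ifs
  · rw [← integral_const_mul]
    exact integral_congr_ae (ae_of_all _ fun p => by ring)
  · rw [← integral_const_mul]
    exact integral_congr_ae (ae_of_all _ fun p => by ring)

instance isAddRightInvariant_volume_complex_prod_real :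
    (volume : Measure (ℂ × ℝ)).IsAddRightInvariant := by
  rw [Measure.volume_eq_prod]
  infer_instance

instance isAddLeftInvariant_volume_complex_prod_real :
    (volume : Measure (ℂ × ℝ)).IsAddLeftInvariant := by
  rw [Measure.volume_eq_prod]
  infer_instance

theorem measurePreserving_shear {c : ℂ → ℝ} (hc : Measurable c) :
    MeasurePreserving (fun p : ℂ × ℝ => (p.1, p.2 + c p.1)) := by
  refine (MeasurePreserving.id (volume : Measure ℂ)).skew_product
    (g := fun z t => t + c z) (by unfold Function.uncurry; fun_prop) ?_
  exact ae_of_all _ fun z => (measurePreserving_add_right volume (c z)).map_eq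

theorem measurePreserving_hmul_right (q : ℂ × ℝ) :
    MeasurePreserving (fun p : ℂ × ℝ => hmul p q) := by
  have h1 := measurePreserving_shear
    (c := fun z => (z.re * q.1.im - z.im * q.1.re) / 2) (by fun_prop)
  have h2 := (measurePreserving_add_right (volume : Measure (ℂ × ℝ)) q).comp h1
  have e : (fun p : ℂ × ℝ => hmul p q) = (fun x => x + q) ∘
      fun p : ℂ × ℝ => (p.1, p.2 + (p.1.re * q.1.im - p.1.im * q.1.re) / 2) :=
    funext fun p => Prod.ext rfl (add_right_comm _ _ _)
  rwa [e]

theorem hmul_neg_hmul (p q : ℂ × ℝ) : hmul (hmul p q) (-q) = p := by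
  ext <;> simp [hmul]
  ring

theorem hmul_hmul_neg (p q : ℂ × ℝ) : hmul (hmul p (-q)) q = p := by
  simpa using hmul_neg_hmul p (-q)

theorem measurableEmbedding_hmul_right (q : ℂ × ℝ) :
    MeasurableEmbedding (fun p : ℂ × ℝ => hmul p q) :=
  (MeasurableEquiv.measurableEmbedding
    { toFun := fun p => hmul p q
      invFun := fun p => hmul p (-q)
      left_inv := fun p => hmul_neg_hmul p q
      right_inv := fun p => hmul_hmul_neg p q
      measurable_toFun := (measurePreserving_hmul_right q).measurable
      measurable_invFun := (measurePreserving_hmul_right (-q)).measurable })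

theorem isAddFundamentalDomain_translated_strip {c : ℂ → ℝ} (hc : Measurable c) :
    IsAddFundamentalDomain (AddSubgroup.zmultiples ((0, π) : ℂ × ℝ))
      {p : ℂ × ℝ | p.2 + c p.1 ∈ Ico 0 π} := by
  refine IsAddFundamentalDomain.mk' ?_ fun x => ?_
  · refine MeasurableSet.nullMeasurableSet ?_
    exact (show Measurable fun p : ℂ × ℝ => p.2 + c p.1 by fun_prop) measurableSet_Ico
  have hinj : Function.Injective fun n : ℤ => n • ((0, π) : ℂ × ℝ) := fun m n h => by
    have := congrArg Prod.snd h
    simpa [pi_ne_zero] using this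
  have : Function.Bijective (codRestrict (fun n : ℤ => n • ((0, π) : ℂ × ℝ))
      (AddSubgroup.zmultiples ((0, π) : ℂ × ℝ)) fun n => ⟨n, rfl⟩) :=
    (Equiv.ofInjective (fun n : ℤ => n • ((0, π) : ℂ × ℝ)) hinj).bijective
  refine this.existsUnique_iff.2 ?_
  have h := existsUnique_add_zsmul_mem_Ico pi_pos (x.2 + c x.1) 0
  simpa [AddSubgroup.vadd_def, add_comm, add_left_comm, add_assoc] using h

theorem isAddFundamentalDomain_strip :
    IsAddFundamentalDomain (AddSubgroup.zmultiples ((0, π) : ℂ × ℝ))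
      ((univ : Set ℂ) ×ˢ Ico (0 : ℝ) π) := by
  convert isAddFundamentalDomain_translated_strip (c := fun _ => 0) measurable_const using 1
  ext p
  simp

theorem isAddFundamentalDomain_preimage_hmul (q : ℂ × ℝ) :
    IsAddFundamentalDomain (AddSubgroup.zmultiples ((0, π) : ℂ × ℝ))
      ((fun p => hmul p q) ⁻¹' ((univ : Set ℂ) ×ˢ Ico (0 : ℝ) π)) := by
  convert isAddFundamentalDomain_translated_strip
    (c := fun z => q.2 + (z.re * q.1.im - z.im * q.1.re) / 2) (by fun_prop) using 1
  ext p
  simp [hmul, add_assoc]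

theorem apply_zmultiples_vadd {E : Type*} {f : ℂ × ℝ → E}
    (hf : ∀ z t, f (z, t + π) = f (z, t))
    (γ : AddSubgroup.zmultiples ((0, π) : ℂ × ℝ)) (p : ℂ × ℝ) : f (γ +ᵥ p) = f p := by
  obtain ⟨_, n, rfl⟩ := γ
  have : Function.Periodic (fun t => f (p.1, t)) π := fun t => hf p.1 t
  have h := this.zsmul n p.2
  simpa [AddSubgroup.vadd_def, add_comm, Prod.add_def] using h

/-- Right translation on the Heisenberg group preserves integrals over one period. -/
theorem setIntegral_strip_comp_hmul {E : Type*} [NormedAddCommGroup E] [NormedSpace ℝ E]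
    {f : ℂ × ℝ → E} (hf : ∀ z t, f (z, t + π) = f (z, t)) (q : ℂ × ℝ) :
    ∫ p in (univ : Set ℂ) ×ˢ Ico (0 : ℝ) π, f (hmul p q) =
      ∫ p in (univ : Set ℂ) ×ˢ Ico (0 : ℝ) π, f p := by
  have h := (measurePreserving_hmul_right q).setIntegral_preimage_emb
    (measurableEmbedding_hmul_right q) f ((fun p => hmul p (-q)) ⁻¹'
      ((univ : Set ℂ) ×ˢ Ico (0 : ℝ) π))
  simp only [← preimage_comp, Function.comp_def, hmul_neg_hmul, preimage_id'] at h
  rw [h]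
  exact (isAddFundamentalDomain_preimage_hmul (-q)).setIntegral_eq isAddFundamentalDomain_strip
    (apply_zmultiples_vadd hf)

theorem integrableOn_strip_comp_hmul {E : Type*} [NormedAddCommGroup E]
    {f : ℂ × ℝ → E} (hf : ∀ z t, f (z, t + π) = f (z, t))
    (hint : IntegrableOn f ((univ : Set ℂ) ×ˢ Ico (0 : ℝ) π)) (q : ℂ × ℝ) :
    IntegrableOn (fun p => f (hmul p q)) ((univ : Set ℂ) ×ˢ Ico (0 : ℝ) π) := by
  have h := (measurePreserving_hmul_right q).integrableOn_comp_preimage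
    (measurableEmbedding_hmul_right q) (f := f) (s := (fun p => hmul p (-q)) ⁻¹'
      ((univ : Set ℂ) ×ˢ Ico (0 : ℝ) π))
  simp only [← preimage_comp, Function.comp_def, hmul_neg_hmul, preimage_id'] at h
  rw [h]
  exact ((isAddFundamentalDomain_preimage_hmul (-q)).integrableOn_iff isAddFundamentalDomain_strip
    (apply_zmultiples_vadd hf)).2 hint

theorem aestronglyMeasurable_of_strip {E : Type*} [TopologicalSpace E]
    [TopologicalSpace.PseudoMetrizableSpace E]
    {f : ℂ × ℝ → E} (hf : ∀ z t, f (z, t + π) = f (z, t))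
    (h : AEStronglyMeasurable f
      (volume.restrict ((univ : Set ℂ) ×ˢ Ico (0 : ℝ) π))) :
    AEStronglyMeasurable f := by
  have hD := isAddFundamentalDomain_strip
  rw [← hD.sum_restrict, aestronglyMeasurable_sum_measure_iff]
  intro γ
  exact (hD.aestronglyMeasurable_on_iff (hD.vadd_of_comm γ) (apply_zmultiples_vadd hf)).1 h

theorem continuous_geo (lam : ℝ) : Continuous (geo lam) := by
  unfold geo
  fun_prop

theorem integrable_comp_hmul_geo {g : ℂ × ℝ → ℂ} (hper : ∀ z t, g (z, t + π) = g (z, t))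
    (hint : IntegrableOn g ((univ : Set ℂ) ×ˢ Ico (0 : ℝ) π)) (lam a b : ℝ) :
    Integrable (fun x : ℝ × (ℂ × ℝ) => g (hmul x.2 (geo lam x.1)))
      ((volume.restrict (uIoc a b)).prod
        (volume.restrict ((univ : Set ℂ) ×ˢ Ico (0 : ℝ) π))) := by
  have hmeas : Measurable fun x : ℝ × (ℂ × ℝ) => hmul x.2 (geo lam x.1) := by
    have := (continuous_geo lam).measurable
    unfold hmul
    fun_prop
  have hmp : MeasurePreserving
      (fun x : ℝ × (ℂ × ℝ) => (x.1, hmul x.2 (geo lam x.1)))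
      (volume.prod volume) (volume.prod volume) :=
    (MeasurePreserving.id volume).skew_product (g := fun s p => hmul p (geo lam s)) hmeas
      (ae_of_all _ fun s => (measurePreserving_hmul_right (geo lam s)).map_eq)
  have haesm : AEStronglyMeasurable (fun x : ℝ × (ℂ × ℝ) => g (hmul x.2 (geo lam x.1)))
      (volume.prod volume) :=
    (aestronglyMeasurable_of_strip hper hint.aestronglyMeasurable).comp_quasiMeasurePreserving
      (Measure.quasiMeasurePreserving_snd.comp hmp.quasiMeasurePreserving)
  rw [integrable_prod_iff (by rw [Measure.prod_restrict]; exact haesm.restrict)]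
  refine ⟨ae_of_all _ fun s => integrableOn_strip_comp_hmul hper hint (geo lam s), ?_⟩
  have e (s : ℝ) : ∫ p in (univ : Set ℂ) ×ˢ Ico (0 : ℝ) π, ‖g (hmul p (geo lam s))‖ =
      ∫ p in (univ : Set ℂ) ×ˢ Ico (0 : ℝ) π, ‖g p‖ :=
    setIntegral_strip_comp_hmul (f := fun p => ‖g p‖) (fun z t => by rw [hper]) _
  simp only [e]
  rw [uIoc]
  exact integrable_const _

/-- **Fourier multiplier of the reduced X-ray transform:**
for `g` π-periodic in `t` and integrable on `ℂ×[0,π)`,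
`𝓕_{ℍ/Γ}(I^red g)(n) = 2π 𝒥_n ∘ 𝓕_{ℍ/Γ}(g)(n)` pointwise on `𝓗`. -/
theorem reduced_xray_multiplier (g : ℂ × ℝ → ℂ)
    (hper : ∀ z : ℂ, ∀ t : ℝ, g (z, t + π) = g (z, t))
    (hint : IntegrableOn g ((Set.univ : Set ℂ) ×ˢ Set.Ico (0 : ℝ) π))
    (n : ℤ) (hn : n ≠ 0) (F : ℂ → ℂ) (hF : InFock F) (ζ : ℂ) :
    ∫ p in (Set.univ : Set ℂ) ×ˢ Set.Ico (0 : ℝ) π,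
        (∫ s in (0 : ℝ)..(2 * π), g (hmul p (geo 1 s))) * betaStar (n : ℝ) p F ζ
      = ((2 * π : ℝ) : ℂ) *
          Jop n 1
            (fun ξ => ∫ p in (Set.univ : Set ℂ) ×ˢ Set.Ico (0 : ℝ) π,
              g p * betaStar (n : ℝ) p F ξ) ζ := by
  obtain ⟨C, hC⟩ := hF.exists_norm_betaStar_le n ζ
  have hcont := continuous_betaStar hF.1.continuous n ζ
  have hI : Integrable
      (Function.uncurry fun (s : ℝ) (p : ℂ × ℝ) => g (hmul p (geo 1 s)) * betaStar n p F ζ)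
      ((volume.restrict (uIoc 0 (2 * π))).prod
        (volume.restrict ((univ : Set ℂ) ×ˢ Ico (0 : ℝ) π))) :=
    (integrable_comp_hmul_geo hper hint 1 0 (2 * π)).mul_bdd
      (hcont.comp continuous_snd).aestronglyMeasurable (ae_of_all _ fun x => hC x.2)
  simp_rw [← intervalIntegral.integral_mul_const]
  rw [← intervalIntegral_integral_swap hI, Jop, ← mul_assoc, ← Complex.ofReal_mul,
    mul_one_div_cancel two_pi_pos.ne', Complex.ofReal_one, one_mul]
  refine intervalIntegral.integral_congr fun s _ => ?_
  have hgeo : geo 1 s = (1 * Complex.exp (Complex.I * (s : ℂ)), s / 2) := by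
    simp [geo]
  have hb (p : ℂ × ℝ) : betaStar n p F ζ =
      beta n (geo 1 s).1 (geo 1 s).2 (betaStar n (hmul p (geo 1 s)) F) ζ := by
    rw [← betaStar_hmul_inv, hmul_neg_hmul]
  simp only [hb]
  rw [setIntegral_strip_comp_hmul
    (f := fun p => g p * beta n (geo 1 s).1 (geo 1 s).2 (betaStar n p F) ζ), ← beta_integral, hgeo]
  intro z t
  rw [hper]
  congr 2
  ext ξ
  exact betaStar_add_pi n z t F ξ

end
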